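/- Let 0 < α < β < ∞. Then ∫₀¹ | n^{1/α} x_n(ω) − (1/2)(α p₁)^{-1/α} | dω → 0 as n → ∞; that is, n^{1/α} x_n converges to (1/2)(α p₁)^{-1/α} in L¹ of the Lebesgue measure on [0,1]. -/

import Mathlib

open MeasureTheory Filter Set Topology

noncomputable section

/-- The Liverani–Saussol–Vaienti map `T_a` on `[0,1]`. -/
def lsv (a x : ℝ) : ℝ := if x ≤ 1 / 2 then x * (1 + (2 : ℝ) ^ a * x ^ a) else 2 * x - 1

/-- Random parameter selection: `α` on `[0,p₁)`, `β` on `[p₁,1]`. -/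
def alphaOf (α β p₁ ω : ℝ) : ℝ := if ω < p₁ then α else β

/-- The noise dynamics `φ` on `[0,1]`. -/
def phiMap (p₁ ω : ℝ) : ℝ := if ω < p₁ then ω / p₁ else (ω - p₁) / (1 - p₁)

/-- The skew product `S(x,ω) = (T_{α(ω)} x, φ ω)`. -/
def skewLSV (α β p₁ : ℝ) (p : ℝ × ℝ) : ℝ × ℝ :=
  (lsv (alphaOf α β p₁ p.2) p.1, phiMap p₁ p.2)

/-- The base of inducing, `Δ₀ = (1/2,1] × [0,1]`. -/
def Δ0 : Set (ℝ × ℝ) := Ioc (1 / 2 : ℝ) 1 ×ˢ Icc (0 : ℝ) 1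

section RealPowers

lemma one_sub_mul_le_rpow_neg {t r : ℝ} (ht : 0 < t) (hr : 0 ≤ r) :
    1 - r * (t - 1) ≤ t ^ (-r) := by
  rw [Real.rpow_def_of_pos ht]
  nlinarith [Real.add_one_le_exp (Real.log t * -r), Real.log_le_sub_one_of_pos ht]

lemma one_add_rpow_neg_le {s a : ℝ} (hs : 0 ≤ s) (ha : 0 ≤ a) :
    (1 + s) ^ (-a) ≤ 1 - a * s / (1 + (1 + a) * s) := by
  have h1 : (0 : ℝ) < 1 + s := by linarith
  have h2 : (0 : ℝ) < 1 + (1 + a) * s := by positivity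
  have h := one_sub_mul_le_rpow_neg (inv_pos.2 h1) ha
  rw [Real.inv_rpow h1.le] at h
  have h3 : 1 - a * ((1 + s)⁻¹ - 1) = (1 + (1 + a) * s) / (1 + s) := by field_simp; ring
  have h4 : 1 - a * s / (1 + (1 + a) * s) = ((1 + (1 + a) * s) / (1 + s))⁻¹ := by
    field_simp; ring
  rw [h3] at h
  rw [h4, le_inv_comm₀ (Real.rpow_pos_of_pos h1 _) (by positivity)]
  exact h

lemma rpow_neg_sub_le {v c r : ℝ} (hv : 0 < v) (hc : 0 < c) (hr : 0 ≤ r) :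
    c ^ (-r) - v ^ (-r) ≤ r * |v - c| * c ^ (-r - 1) := by
  have h := one_sub_mul_le_rpow_neg (div_pos hv hc) hr
  rw [Real.div_rpow hv.le hc.le, le_div_iff₀ (Real.rpow_pos_of_pos hc _)] at h
  have h1 : c ^ (-r) = c * c ^ (-r - 1) := by
    rw [Real.rpow_sub_one hc.ne']; field_simp
  have h2 : (1 - r * (v / c - 1)) * c ^ (-r) = c ^ (-r) - r * (v - c) * c ^ (-r - 1) := by
    rw [h1]; field_simp
  have h3 : r * (v - c) * c ^ (-r - 1) ≤ r * |v - c| * c ^ (-r - 1) := by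
    gcongr; exact le_abs_self _
  linarith

lemma abs_rpow_neg_sub_le {v c r : ℝ} (hv : 0 < v) (hc : 0 < c) (hr : 0 ≤ r) :
    |v ^ (-r) - c ^ (-r)| ≤ r * |v - c| * (v ^ (-r - 1) + c ^ (-r - 1)) := by
  have h1 := rpow_neg_sub_le hv hc hr
  have h2 := rpow_neg_sub_le hc hv hr
  rw [abs_sub_comm] at h2
  have h3 : 0 ≤ r * |v - c| * v ^ (-r - 1) := by positivity
  have h4 : 0 ≤ r * |v - c| * c ^ (-r - 1) := by positivity
  rw [abs_le]
  constructor <;> linarith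

/-- A quadratic form of `abs_rpow_neg_sub_le`, with a free parameter `δ`. -/
lemma abs_rpow_neg_sub_le_sq {v c r δ : ℝ} (hv : 0 < v) (hc : 0 < c) (hr : 0 ≤ r) (hδ : 0 < δ) :
    |v ^ (-r) - c ^ (-r)| ≤
      r * ((v - c) ^ 2 / δ + δ * (v ^ (-(2 * r + 2)) + c ^ (-(2 * r + 2)))) := by
  have hsq : ∀ x : ℝ, 0 < x → x ^ (-(2 * r + 2)) = (x ^ (-r - 1)) ^ 2 := fun x hx ↦ by
    rw [← Real.rpow_natCast, ← Real.rpow_mul hx.le]; congr 1; push_cast; ring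
  refine (abs_rpow_neg_sub_le hv hc hr).trans ?_
  rw [hsq v hv, hsq c hc, mul_assoc, ← sq_abs (v - c)]
  generalize |v - c| = a
  generalize v ^ (-r - 1) = x
  generalize c ^ (-r - 1) = y
  refine mul_le_mul_of_nonneg_left ?_ hr
  have : a ^ 2 / δ + δ * (x ^ 2 + y ^ 2) - a * (x + y) =
      ((a - δ * (x + y) / 2) ^ 2 + δ ^ 2 * ((x ^ 2 + y ^ 2) - (x + y) ^ 2 / 4)) / δ := by
    field_simp; ring
  have : 0 ≤ a ^ 2 / δ + δ * (x ^ 2 + y ^ 2) - a * (x + y) := by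
    rw [this]
    have : 0 ≤ (x ^ 2 + y ^ 2) - (x + y) ^ 2 / 4 := by nlinarith [sq_nonneg (x - y), sq_nonneg (x + y)]
    positivity
  linarith

end RealPowers

section NoiseDynamics

lemma measurable_phiMap (p : ℝ) : Measurable (phiMap p) := by
  unfold phiMap
  exact Measurable.ite measurableSet_Iio (by fun_prop) (by fun_prop)

lemma integrableOn_Icc_of_abs_le {f : ℝ → ℝ} {C : ℝ} (hf : Measurable f) (hC : ∀ ω, |f ω| ≤ C) :
    IntegrableOn f (Icc 0 1) :=
  Measure.integrableOn_of_bounded (M := C) (by simp) hf.aestronglyMeasurable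
    (Eventually.of_forall hC)

lemma setIntegral_Icc_add_add_const {f g : ℝ → ℝ} (hf : IntegrableOn f (Icc 0 1))
    (hg : IntegrableOn g (Icc 0 1)) (a b c : ℝ) :
    ∫ ω in Icc (0 : ℝ) 1, (a * f ω + b * g ω + c) =
      a * (∫ ω in Icc (0 : ℝ) 1, f ω) + b * (∫ ω in Icc (0 : ℝ) 1, g ω) + c := by
  rw [integral_add (f := fun ω ↦ a * f ω + b * g ω) ((hf.const_mul a).add (hg.const_mul b))
    (integrable_const _), integral_add (hf.const_mul a) (hg.const_mul b), integral_const_mul,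
    integral_const_mul]
  simp

/-- The two branches of `phiMap p` are affine and onto `[0,1]`. -/
lemma setIntegral_ite_comp_phiMap {p : ℝ} (hp : 0 < p) (hp' : p < 1) {A B : ℝ → ℝ} {C : ℝ}
    (hA : Measurable A) (hB : Measurable B) (hAC : ∀ ω, |A ω| ≤ C) (hBC : ∀ ω, |B ω| ≤ C) :
    ∫ ω in Icc (0 : ℝ) 1, (if ω < p then A (phiMap p ω) else B (phiMap p ω)) =
      p * (∫ ω in Icc (0 : ℝ) 1, A ω) + (1 - p) * ∫ ω in Icc (0 : ℝ) 1, B ω := by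
  set F : ℝ → ℝ := fun ω ↦ if ω < p then A (phiMap p ω) else B (phiMap p ω) with hF
  have hFm : Measurable F := Measurable.ite measurableSet_Iio
    (hA.comp (measurable_phiMap p)) (hB.comp (measurable_phiMap p))
  have hFC : ∀ ω, |F ω| ≤ C := fun ω ↦ by
    simp only [hF]; split_ifs
    exacts [hAC _, hBC _]
  have hint : ∀ a b : ℝ, IntervalIntegrable F volume a b := fun a b ↦
    intervalIntegrable_iff.2 <| Measure.integrableOn_of_bounded (M := C) (by simp)
      hFm.aestronglyMeasurable (Eventually.of_forall hFC)
  have hq : 0 < 1 - p := by linarith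
  have hl : ∫ ω in (0 : ℝ)..p, F ω = p * ∫ ω in (0 : ℝ)..1, A ω := by
    rw [intervalIntegral.integral_congr_Ioo_of_le (g := fun ω ↦ A (ω / p)) hp.le
      (fun ω hω ↦ by simp [hF, phiMap, hω.2]), intervalIntegral.integral_comp_div _ hp.ne']
    simp [hp.ne']
  have hr : ∫ ω in p..1, F ω = (1 - p) * ∫ ω in (0 : ℝ)..1, B ω := by
    rw [intervalIntegral.integral_congr_Ioo_of_le (g := fun ω ↦ B (ω / (1 - p) - p / (1 - p)))
      hp'.le (fun ω hω ↦ by simp [hF, phiMap, hω.1.le.not_gt, sub_div]),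
      intervalIntegral.integral_comp_div_sub _ hq.ne', ← sub_div, ← sub_div,
      sub_self, zero_div, div_self hq.ne', smul_eq_mul]
  simp only [integral_Icc_eq_integral_Ioc, ← intervalIntegral.integral_of_le zero_le_one]
  rw [← intervalIntegral.integral_add_adjacent_intervals (hint 0 p) (hint p 1), hl, hr]

end NoiseDynamics

section DriftProcess

/-- A process over `phiMap p` with nonnegative increments which are asymptotically `α` over `[0,p)`
and `0` over `[p,1]`, with an error controlled by a negative power of the process itself. -/
structure IsDriftProcess (α p c₀ K κ : ℝ) (U : ℕ → ℝ → ℝ) : Prop where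
  measurable : ∀ n, Measurable (U n)
  zero : ∀ ω, U 0 ω = 1
  add_le_succ : ∀ n ω, ω < p → U n (phiMap p ω) + c₀ ≤ U (n + 1) ω
  le_succ : ∀ n ω, U n (phiMap p ω) ≤ U (n + 1) ω
  abs_error_le : ∀ n ω,
    |U (n + 1) ω - U n (phiMap p ω) - (if ω < p then α else 0)| ≤ K * U (n + 1) ω ^ (-κ)

namespace IsDriftProcess

variable {α p c₀ K κ : ℝ} {U : ℕ → ℝ → ℝ}

lemma one_le (h : IsDriftProcess α p c₀ K κ U) (n : ℕ) : ∀ ω, 1 ≤ U n ω := by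
  induction n with
  | zero => exact fun ω ↦ (h.zero ω).ge
  | succ n ih => exact fun ω ↦ (ih _).trans (h.le_succ n ω)

lemma pos (h : IsDriftProcess α p c₀ K κ U) (n : ℕ) (ω : ℝ) : 0 < U n ω :=
  zero_lt_one.trans_le (h.one_le n ω)

lemma rpow_neg_le_one (h : IsDriftProcess α p c₀ K κ U) {q : ℝ} (hq : 0 ≤ q) (n : ℕ) (ω : ℝ) :
    U n ω ^ (-q) ≤ 1 :=
  Real.rpow_le_one_of_one_le_of_nonpos (h.one_le n ω) (by linarith)

lemma le_linear (h : IsDriftProcess α p c₀ K κ U) (hα : 0 ≤ α) (hK : 0 ≤ K) (hκ : 0 ≤ κ) (n : ℕ) :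
    ∀ ω, U n ω ≤ (1 + α + K) * (n + 1) := by
  induction n with
  | zero => intro ω; rw [h.zero]; push_cast; linarith
  | succ n ih =>
    intro ω
    have h1 := (abs_le.1 (h.abs_error_le n ω)).2
    have h2 : K * U (n + 1) ω ^ (-κ) ≤ K := mul_le_of_le_one_right hK (h.rpow_neg_le_one hκ _ _)
    have h3 : (if ω < p then α else 0) ≤ α := by split_ifs <;> linarith
    have := ih (phiMap p ω)
    push_cast
    linarith

lemma integrableOn_rpow_neg (h : IsDriftProcess α p c₀ K κ U) {q : ℝ} (hq : 0 ≤ q) (n : ℕ) :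
    IntegrableOn (fun ω ↦ U n ω ^ (-q)) (Icc 0 1) :=
  integrableOn_Icc_of_abs_le (C := 1) ((h.measurable n).pow_const _) fun ω ↦ by
    rw [abs_of_pos (Real.rpow_pos_of_pos (h.pos n ω) _)]
    exact h.rpow_neg_le_one hq n ω

lemma abs_exp_neg_le (h : IsDriftProcess α p c₀ K κ U) (n : ℕ) (ω : ℝ) :
    |Real.exp (-U n ω)| ≤ 1 := by
  rw [Real.abs_exp, Real.exp_le_one_iff]
  linarith [h.pos n ω]

lemma integral_exp_neg_le (h : IsDriftProcess α p c₀ K κ U) (hp : 0 < p) (hp' : p < 1)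
    (hc₀ : 0 ≤ c₀) (n : ℕ) :
    ∫ ω in Icc (0 : ℝ) 1, Real.exp (-U n ω) ≤ (p * Real.exp (-c₀) + (1 - p)) ^ n := by
  have hm : ∀ n, Measurable fun ω ↦ Real.exp (-U n ω) := fun n ↦ (h.measurable n).neg.exp
  induction n with
  | zero => simp [h.zero]
  | succ n ih =>
    have he : Real.exp (-c₀) ≤ 1 := Real.exp_le_one_iff.2 (by linarith)
    have hA : ∀ ω, |Real.exp (-c₀) * Real.exp (-U n ω)| ≤ 1 := fun ω ↦ by
      rw [abs_mul, Real.abs_exp]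
      exact mul_le_one₀ he (abs_nonneg _) (h.abs_exp_neg_le n ω)
    calc ∫ ω in Icc (0 : ℝ) 1, Real.exp (-U (n + 1) ω)
      _ ≤ ∫ ω in Icc (0 : ℝ) 1, (if ω < p then Real.exp (-c₀) * Real.exp (-U n (phiMap p ω))
            else Real.exp (-U n (phiMap p ω))) := by
          refine setIntegral_mono (integrableOn_Icc_of_abs_le (hm _) (h.abs_exp_neg_le _))
            (integrableOn_Icc_of_abs_le (C := 1) ?_ fun ω ↦ ?_) fun ω ↦ ?_
          · exact Measurable.ite measurableSet_Iio
              (((hm n).comp (measurable_phiMap p)).const_mul _) ((hm n).comp (measurable_phiMap p))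
          · split_ifs
            exacts [hA _, h.abs_exp_neg_le _ _]
          · dsimp only
            split_ifs with hω
            · rw [← Real.exp_add, Real.exp_le_exp]
              linarith [h.add_le_succ n ω hω]
            · rw [Real.exp_le_exp]
              linarith [h.le_succ n ω]
      _ = (p * Real.exp (-c₀) + (1 - p)) * ∫ ω in Icc (0 : ℝ) 1, Real.exp (-U n ω) := by
          rw [setIntegral_ite_comp_phiMap (A := fun ω ↦ Real.exp (-c₀) * Real.exp (-U n ω))
            (B := fun ω ↦ Real.exp (-U n ω)) hp hp' ((hm n).const_mul _) (hm n) hA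
            (h.abs_exp_neg_le n), integral_const_mul]
          ring
      _ ≤ _ := by
          rw [pow_succ']
          have : 0 < 1 - p := by linarith
          exact mul_le_mul_of_nonneg_left ih (by positivity)

lemma exists_integral_rpow_neg_le (h : IsDriftProcess α p c₀ K κ U) (hp : 0 < p) (hp' : p < 1)
    (hc₀ : 0 < c₀) {q : ℝ} (hq : 0 ≤ q) :
    ∃ M : ℝ, 0 ≤ M ∧
      ∀ n : ℕ, ∫ ω in Icc (0 : ℝ) 1, U n ω ^ (-q) ≤ M * ((n : ℝ) + 1) ^ (-q) := by
  set ρ := p * Real.exp (-c₀) + (1 - p) with hρ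
  have hρ0 : 0 < ρ := by
    have : 0 < 1 - p := by linarith
    positivity
  have hρ1 : ρ < 1 := by
    have : Real.exp (-c₀) < 1 := by rw [← Real.exp_zero, Real.exp_lt_exp]; linarith
    nlinarith
  set ε := -Real.log ρ / 2 with hε
  have hε0 : 0 < ε := by have := Real.log_neg hρ0 hρ1; simp only [hε]; linarith
  have hlim : Tendsto (fun n : ℕ ↦ ((n : ℝ) + 1) ^ q * Real.exp (-ε * ((n : ℝ) + 1))) atTop (𝓝 0) :=
    (tendsto_rpow_mul_exp_neg_mul_atTop_nhds_zero q ε hε0).comp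
      (tendsto_atTop_add_const_right _ 1 tendsto_natCast_atTop_atTop)
  obtain ⟨B, hB⟩ := hlim.bddAbove_range
  have hB0 : 0 ≤ B := le_trans (by positivity) (hB ⟨0, rfl⟩)
  refine ⟨ε ^ (-q) + ρ⁻¹ * B, by positivity, fun n ↦ ?_⟩
  set N : ℝ := (n : ℝ) + 1 with hN
  have hN0 : 0 < N := by positivity
  have hpt : ∀ ω, U n ω ^ (-q) ≤ (ε * N) ^ (-q) + Real.exp (ε * N) * Real.exp (-U n ω) := by
    intro ω
    rcases le_total (ε * N) (U n ω) with hle | hle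
    · have h1 := Real.rpow_le_rpow_of_nonpos (by positivity) hle (neg_nonpos.2 hq)
      have : 0 < Real.exp (ε * N) * Real.exp (-U n ω) := by positivity
      linarith
    · have h1 := h.rpow_neg_le_one hq n ω
      have h2 : 1 ≤ Real.exp (ε * N) * Real.exp (-U n ω) := by
        rw [← Real.exp_add, Real.one_le_exp_iff]; linarith
      have : 0 < (ε * N) ^ (-q) := by positivity
      linarith
  have hexp : IntegrableOn (fun ω ↦ Real.exp (-U n ω)) (Icc 0 1) :=
    integrableOn_Icc_of_abs_le (h.measurable n).neg.exp (h.abs_exp_neg_le n)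
  have hρn : Real.exp (ε * N) * ρ ^ n = ρ⁻¹ * Real.exp (-ε * N) := by
    have hpow : ρ ^ n = ρ⁻¹ * Real.exp (-(2 * ε) * N) := by
      have : -(2 * ε) * N = Real.log ρ * ((n + 1 : ℕ) : ℝ) := by
        simp only [hε, hN]; push_cast; ring
      rw [this, ← Real.rpow_def_of_pos hρ0, Real.rpow_natCast, pow_succ]
      field_simp
    rw [hpow, mul_left_comm, ← Real.exp_add]
    ring_nf
  calc ∫ ω in Icc (0 : ℝ) 1, U n ω ^ (-q)
    _ ≤ ∫ ω in Icc (0 : ℝ) 1, ((ε * N) ^ (-q) + Real.exp (ε * N) * Real.exp (-U n ω)) :=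
        setIntegral_mono (h.integrableOn_rpow_neg hq n)
          ((integrable_const _).add (hexp.const_mul _)) hpt
    _ = (ε * N) ^ (-q) + Real.exp (ε * N) * ∫ ω in Icc (0 : ℝ) 1, Real.exp (-U n ω) := by
        rw [integral_add (integrable_const _) (hexp.const_mul _), integral_const_mul]
        simp
    _ ≤ (ε * N) ^ (-q) + Real.exp (ε * N) * ρ ^ n := by
        gcongr; exact h.integral_exp_neg_le hp hp' hc₀.le n
    _ = (ε ^ (-q) + ρ⁻¹ * (N ^ q * Real.exp (-ε * N))) * N ^ (-q) := by
        rw [hρn, Real.mul_rpow hε0.le hN0.le, add_mul, mul_assoc, mul_right_comm,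
          ← Real.rpow_add hN0, add_neg_cancel, Real.rpow_zero, one_mul]
    _ ≤ _ := by
        gcongr
        exact hB ⟨n, rfl⟩

lemma tendsto_integral_rpow_neg (h : IsDriftProcess α p c₀ K κ U) (hp : 0 < p) (hp' : p < 1)
    (hc₀ : 0 < c₀) {q : ℝ} (hq : 0 < q) :
    Tendsto (fun n ↦ ∫ ω in Icc (0 : ℝ) 1, U n ω ^ (-q)) atTop (𝓝 0) := by
  obtain ⟨M, -, hM⟩ := h.exists_integral_rpow_neg_le hp hp' hc₀ hq.le
  refine squeeze_zero (fun n ↦ integral_nonneg fun ω ↦ (Real.rpow_pos_of_pos (h.pos n ω) _).le) hM ?_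
  have := ((tendsto_rpow_neg_atTop hq).comp
    (tendsto_atTop_add_const_right _ (1 : ℝ) tendsto_natCast_atTop_atTop)).const_mul M
  simpa using this

lemma abs_sub_linear_le (h : IsDriftProcess α p c₀ K κ U) (hα : 0 ≤ α) (hp : 0 < p) (hp' : p < 1)
    (hK : 0 ≤ K) (hκ : 0 ≤ κ) (n : ℕ) (ω : ℝ) :
    |U n ω - α * p * (n + 1)| ≤ (1 + α + K) * (n + 1) := by
  have h1 := h.le_linear hα hK hκ n ω
  have h2 := h.pos n ω
  have h3 : 0 ≤ α * p * ((n : ℝ) + 1) := by positivity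
  have h4 : α * p * ((n : ℝ) + 1) ≤ (1 + α + K) * (n + 1) := by
    gcongr; nlinarith
  rw [abs_le]
  constructor <;> linarith

lemma integral_sq_succ_le (h : IsDriftProcess α p c₀ K κ U) (hα : 0 ≤ α) (hp : 0 < p) (hp' : p < 1)
    (hK : 0 ≤ K) (hκ : 0 ≤ κ) (n : ℕ) :
    ∫ ω in Icc (0 : ℝ) 1, (U (n + 1) ω - α * p * ((n + 1 : ℕ) + 1)) ^ 2 ≤
      (∫ ω in Icc (0 : ℝ) 1, (U n ω - α * p * (n + 1)) ^ 2) + α ^ 2 +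
        (n + 1) * ((2 * (1 + 2 * α + K) + K) * K * ∫ ω in Icc (0 : ℝ) 1, U (n + 1) ω ^ (-κ)) := by
  set D : ℝ → ℝ := fun ω ↦ U n ω - α * p * (n + 1) with hD
  set L : ℝ := (1 + α + K) * (n + 1) with hL
  have hDm : Measurable D := (h.measurable n).sub_const _
  have hDL : ∀ ω, |D ω| ≤ L := h.abs_sub_linear_le hα hp hp' hK hκ n
  have hDL' : ∀ x ω, |x| ≤ α → |D ω + x| ≤ L + α := fun x ω hx ↦
    (abs_add_le _ _).trans (add_le_add (hDL ω) hx)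
  have hx₁ : |α * (1 - p)| ≤ α := by
    rw [abs_of_nonneg (mul_nonneg hα (by linarith))]; nlinarith
  have hx₂ : |-(α * p)| ≤ α := by
    rw [abs_neg, abs_of_nonneg (mul_nonneg hα hp.le)]; nlinarith
  have hsq : ∀ x ω, |x| ≤ α → |(D ω + x) ^ 2| ≤ (L + α) ^ 2 := fun x ω hx ↦ by
    rw [abs_pow]
    exact pow_le_pow_left₀ (abs_nonneg _) (hDL' x ω hx) 2
  set G : ℝ → ℝ := fun ω ↦ if ω < p then (D (phiMap p ω) + α * (1 - p)) ^ 2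
    else (D (phiMap p ω) + -(α * p)) ^ 2 with hG
  have hDφ : Measurable fun ω ↦ D (phiMap p ω) := hDm.comp (measurable_phiMap p)
  have hGi : IntegrableOn G (Icc 0 1) := by
    refine integrableOn_Icc_of_abs_le (C := (L + α) ^ 2) (Measurable.ite measurableSet_Iio
      ((hDφ.add_const _).pow_const 2) ((hDφ.add_const _).pow_const 2)) fun ω ↦ ?_
    simp only [hG]
    split_ifs
    exacts [hsq _ _ hx₁, hsq _ _ hx₂]
  have hDi : IntegrableOn D (Icc 0 1) := integrableOn_Icc_of_abs_le hDm hDL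
  have hD2i : IntegrableOn (fun ω ↦ D ω ^ 2) (Icc 0 1) :=
    integrableOn_Icc_of_abs_le (C := (L + α) ^ 2) (hDm.pow_const 2) fun ω ↦ by
      simpa using hsq 0 ω (by simpa using hα)
  have hexpand : ∀ x : ℝ, ∫ ω in Icc (0 : ℝ) 1, (D ω + x) ^ 2 =
      (∫ ω in Icc (0 : ℝ) 1, D ω ^ 2) + 2 * x * (∫ ω in Icc (0 : ℝ) 1, D ω) + x ^ 2 := fun x ↦ by
    have : ∀ ω, (D ω + x) ^ 2 = 1 * D ω ^ 2 + 2 * x * D ω + x ^ 2 := fun ω ↦ by ring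
    simp only [this]
    rw [setIntegral_Icc_add_add_const hD2i hDi, one_mul]
  have hGint : ∫ ω in Icc (0 : ℝ) 1, G ω ≤ (∫ ω in Icc (0 : ℝ) 1, D ω ^ 2) + α ^ 2 := by
    simp only [hG]
    rw [setIntegral_ite_comp_phiMap (A := fun ω ↦ (D ω + α * (1 - p)) ^ 2)
      (B := fun ω ↦ (D ω + -(α * p)) ^ 2) hp hp' ((hDm.add_const _).pow_const 2)
      ((hDm.add_const _).pow_const 2) (fun ω ↦ hsq _ ω hx₁) (fun ω ↦ hsq _ ω hx₂),
      hexpand, hexpand]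
    have : 0 ≤ α ^ 2 * (1 - p * (1 - p)) := mul_nonneg (sq_nonneg α) (by nlinarith)
    nlinarith
  have hpt : ∀ ω, (U (n + 1) ω - α * p * ((n + 1 : ℕ) + 1)) ^ 2 ≤
      G ω + (n + 1) * ((2 * (1 + 2 * α + K) + K) * K) * U (n + 1) ω ^ (-κ) := by
    intro ω
    set e := U (n + 1) ω ^ (-κ) with he
    have he0 : 0 < e := Real.rpow_pos_of_pos (h.pos _ _) _
    have he1 : e ≤ 1 := h.rpow_neg_le_one hκ _ _
    have key : ∀ x, |x| ≤ α → |U (n + 1) ω - U n (phiMap p ω) - (x + α * p)| ≤ K * e →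
        (U (n + 1) ω - α * p * ((n + 1 : ℕ) + 1)) ^ 2 ≤ (D (phiMap p ω) + x) ^ 2 +
          (n + 1) * ((2 * (1 + 2 * α + K) + K) * K) * e := by
      intro x hx herr
      set r := U (n + 1) ω - U n (phiMap p ω) - (x + α * p) with hr
      have h1 : U (n + 1) ω - α * p * ((n + 1 : ℕ) + 1) = (D (phiMap p ω) + x) + r := by
        simp only [hr, hD]; push_cast; ring
      have h2 : (D (phiMap p ω) + x) * r ≤ (L + α) * (K * e) := by
        refine (le_abs_self _).trans ?_
        rw [abs_mul]
        exact mul_le_mul (hDL' x _ hx) herr (abs_nonneg _) (by positivity)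
      have h3 : r ^ 2 ≤ K * (K * e) := by
        rw [← sq_abs, sq]
        exact mul_le_mul (herr.trans (mul_le_of_le_one_right hK he1)) herr (abs_nonneg _) hK
      have h4 : 0 ≤ (n : ℝ) * ((2 * α + K) * (K * e)) := by positivity
      rw [h1]
      simp only [hL] at h2
      nlinarith
    have herr := h.abs_error_le n ω
    simp only [hG]
    split_ifs at herr ⊢ with hω
    · exact key _ hx₁ (by convert herr using 3; ring)
    · exact key _ hx₂ (by convert herr using 3; ring)
  have hei := h.integrableOn_rpow_neg hκ (n + 1)
  calc ∫ ω in Icc (0 : ℝ) 1, (U (n + 1) ω - α * p * ((n + 1 : ℕ) + 1)) ^ 2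
    _ ≤ ∫ ω in Icc (0 : ℝ) 1,
          (G ω + (n + 1) * ((2 * (1 + 2 * α + K) + K) * K) * U (n + 1) ω ^ (-κ)) := by
        refine setIntegral_mono (integrableOn_Icc_of_abs_le
          (C := ((1 + α + K) * ((n + 1 : ℕ) + 1)) ^ 2)
          (((h.measurable (n + 1)).sub_const _).pow_const 2) fun ω ↦ ?_)
          (hGi.add (hei.const_mul _)) hpt
        rw [abs_pow]
        exact pow_le_pow_left₀ (abs_nonneg _) (h.abs_sub_linear_le hα hp hp' hK hκ (n + 1) ω) 2
    _ ≤ _ := by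
        rw [integral_add hGi (hei.const_mul _), integral_const_mul, mul_assoc]
        exact add_le_add_left hGint _

lemma tendsto_integral_sq_div_sq (h : IsDriftProcess α p c₀ K κ U) (hα : 0 ≤ α) (hp : 0 < p)
    (hp' : p < 1) (hc₀ : 0 < c₀) (hK : 0 ≤ K) (hκ : 0 < κ) :
    Tendsto (fun n : ℕ ↦ (∫ ω in Icc (0 : ℝ) 1, (U n ω - α * p * (n + 1)) ^ 2) / ((n : ℝ) + 1) ^ 2)
      atTop (𝓝 0) := by
  set V : ℕ → ℝ := fun n ↦ ∫ ω in Icc (0 : ℝ) 1, (U n ω - α * p * (n + 1)) ^ 2 with hV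
  set w : ℕ → ℝ := fun n ↦ α ^ 2 / ((n : ℝ) + 1) +
    (2 * (1 + 2 * α + K) + K) * K * ∫ ω in Icc (0 : ℝ) 1, U (n + 1) ω ^ (-κ) with hw
  have hV0 : ∀ n, 0 ≤ V n := fun n ↦ integral_nonneg fun ω ↦ sq_nonneg _
  have hw0 : ∀ n, 0 ≤ w n := fun n ↦ by
    have : 0 ≤ ∫ ω in Icc (0 : ℝ) 1, U (n + 1) ω ^ (-κ) :=
      integral_nonneg fun ω ↦ (Real.rpow_pos_of_pos (h.pos _ ω) _).le
    positivity
  have hstep : ∀ n : ℕ, V (n + 1) ≤ V n + (n + 1) * w n := fun n ↦ by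
    have h1 := h.integral_sq_succ_le hα hp hp' hK hκ.le n
    have h2 : ((n : ℝ) + 1) * w n = α ^ 2 + (n + 1) * ((2 * (1 + 2 * α + K) + K) * K *
        ∫ ω in Icc (0 : ℝ) 1, U (n + 1) ω ^ (-κ)) := by
      simp only [hw]; field_simp
    rw [h2, ← add_assoc]
    exact h1
  have hsum : ∀ n : ℕ, V n ≤ V 0 + n * ∑ i ∈ Finset.range n, w i := by
    intro n
    induction n with
    | zero => simp
    | succ n ih =>
      rw [Finset.sum_range_succ]
      have h1 : 0 ≤ ∑ i ∈ Finset.range n, w i := Finset.sum_nonneg fun i _ ↦ hw0 i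
      have h2 := hstep n
      push_cast
      nlinarith
  have hwlim : Tendsto w atTop (𝓝 0) := by
    have h1 : Tendsto (fun n : ℕ ↦ α ^ 2 / ((n : ℝ) + 1)) atTop (𝓝 0) :=
      tendsto_const_nhds.div_atTop (tendsto_atTop_add_const_right _ 1 tendsto_natCast_atTop_atTop)
    have h2 := ((tendsto_add_atTop_iff_nat 1).2 (h.tendsto_integral_rpow_neg hp hp' hc₀ hκ)).const_mul
      ((2 * (1 + 2 * α + K) + K) * K)
    simpa using h1.add h2
  have hces := hwlim.cesaro
  have hinv : Tendsto (fun n : ℕ ↦ V 0 / ((n : ℝ) + 1)) atTop (𝓝 0) :=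
    tendsto_const_nhds.div_atTop (tendsto_atTop_add_const_right _ 1 tendsto_natCast_atTop_atTop)
  refine squeeze_zero (fun n ↦ div_nonneg (hV0 n) (by positivity)) (fun n ↦ ?_)
    (by simpa using hinv.add hces)
  rcases n.eq_zero_or_pos with rfl | hn
  · simp [hV]
  have hn' : (0 : ℝ) < n := by exact_mod_cast hn
  have hS : 0 ≤ ∑ i ∈ Finset.range n, w i := Finset.sum_nonneg fun i _ ↦ hw0 i
  calc V n / ((n : ℝ) + 1) ^ 2
    _ ≤ (V 0 + n * ∑ i ∈ Finset.range n, w i) / ((n : ℝ) + 1) ^ 2 := by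
        gcongr; exact hsum n
    _ = V 0 / ((n : ℝ) + 1) ^ 2 + n * (∑ i ∈ Finset.range n, w i) / ((n : ℝ) + 1) ^ 2 := add_div _ _ _
    _ ≤ V 0 / ((n : ℝ) + 1) + n * (∑ i ∈ Finset.range n, w i) / (n : ℝ) ^ 2 := by
        have h0 := hV0 0
        gcongr
        · nlinarith
        · linarith
    _ = _ := by field_simp

/-- Convergence in `L¹` of negative powers of a drift process, after normalization. -/
theorem tendsto_integral_abs_rpow_neg_sub (h : IsDriftProcess α p c₀ K κ U) (hα : 0 < α) (hp : 0 < p)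
    (hp' : p < 1) (hc₀ : 0 < c₀) (hK : 0 ≤ K) (hκ : 0 < κ) {r : ℝ} (hr : 0 < r) :
    Tendsto (fun n : ℕ ↦
      ∫ ω in Icc (0 : ℝ) 1, |(U n ω / ((n : ℝ) + 1)) ^ (-r) - (α * p) ^ (-r)|) atTop (𝓝 0) := by
  obtain ⟨M, hM0, hM⟩ := h.exists_integral_rpow_neg_le hp hp' hc₀ (q := 2 * r + 2) (by positivity)
  set V : ℕ → ℝ := fun n ↦ ∫ ω in Icc (0 : ℝ) 1, (U n ω - α * p * (n + 1)) ^ 2 with hV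
  set z : ℕ → ℝ := fun n ↦ V n / ((n : ℝ) + 1) ^ 2 + 1 / ((n : ℝ) + 1) with hz
  have hz0 : ∀ n, 0 < z n := fun n ↦ by
    have : 0 ≤ V n := integral_nonneg fun ω ↦ sq_nonneg _
    positivity
  have hzlim : Tendsto (fun n ↦ √(z n)) atTop (𝓝 0) := by
    have := (h.tendsto_integral_sq_div_sq hα.le hp hp' hc₀ hK hκ).add
      tendsto_one_div_add_atTop_nhds_zero_nat
    simpa only [add_zero, Real.sqrt_zero] using this.sqrt
  set b := (α * p) ^ (-(2 * r + 2)) with hb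
  have hfin := hzlim.const_mul (r * (1 + (M + b)))
  rw [mul_zero] at hfin
  refine squeeze_zero (fun n ↦ integral_nonneg fun ω ↦ abs_nonneg _) (fun n ↦ ?_) hfin
  set N : ℝ := (n : ℝ) + 1 with hN
  have hN0 : 0 < N := by positivity
  set δ := √(z n) with hδ
  have hδ0 : 0 < δ := Real.sqrt_pos.2 (hz0 n)
  have hc : 0 < α * p := mul_pos hα hp
  have hpt : ∀ ω, |(U n ω / N) ^ (-r) - (α * p) ^ (-r)| ≤
      r / δ / N ^ 2 * (U n ω - α * p * N) ^ 2 +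
        r * δ * N ^ (2 * r + 2) * U n ω ^ (-(2 * r + 2)) + r * δ * b := by
    intro ω
    have hU := h.pos n ω
    refine (abs_rpow_neg_sub_le_sq (div_pos hU hN0) hc hr.le hδ0).trans_eq ?_
    rw [Real.div_rpow hU.le hN0.le, Real.rpow_neg hN0.le]
    rw [hb]
    field_simp
    ring
  have hsqi : IntegrableOn (fun ω ↦ (U n ω - α * p * N) ^ 2) (Icc 0 1) := by
    refine integrableOn_Icc_of_abs_le (C := ((1 + α + K) * N) ^ 2)
      (((h.measurable n).sub_const _).pow_const 2) fun ω ↦ ?_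
    rw [abs_pow]
    exact pow_le_pow_left₀ (abs_nonneg _) (h.abs_sub_linear_le hα.le hp hp' hK hκ.le n ω) 2
  have hpi := h.integrableOn_rpow_neg (q := 2 * r + 2) (by positivity) n
  have hNM : N ^ (2 * r + 2) * ∫ ω in Icc (0 : ℝ) 1, U n ω ^ (-(2 * r + 2)) ≤ M := by
    refine (mul_le_mul_of_nonneg_left (hM n) (by positivity)).trans_eq ?_
    rw [mul_left_comm, ← Real.rpow_add hN0, add_neg_cancel, Real.rpow_zero, mul_one]
  have hVz : V n / N ^ 2 / δ ≤ δ := by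
    rw [div_le_iff₀ hδ0, Real.mul_self_sqrt (hz0 n).le]
    have : 0 < 1 / N := by positivity
    simp only [hz]
    linarith
  calc ∫ ω in Icc (0 : ℝ) 1, |(U n ω / N) ^ (-r) - (α * p) ^ (-r)|
    _ ≤ ∫ ω in Icc (0 : ℝ) 1, (r / δ / N ^ 2 * (U n ω - α * p * N) ^ 2 +
          r * δ * N ^ (2 * r + 2) * U n ω ^ (-(2 * r + 2)) + r * δ * b) :=
        integral_mono_of_nonneg (Eventually.of_forall fun ω ↦ abs_nonneg _)
          (((hsqi.const_mul _).add (hpi.const_mul _)).add (integrable_const _))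
          (Eventually.of_forall hpt)
    _ = r * (V n / N ^ 2 / δ) +
          r * δ * (N ^ (2 * r + 2) * ∫ ω in Icc (0 : ℝ) 1, U n ω ^ (-(2 * r + 2))) + r * δ * b := by
        rw [setIntegral_Icc_add_add_const hsqi hpi]
        simp only [hV, hN]
        ring
    _ ≤ r * δ + r * δ * M + r * δ * b := by gcongr
    _ = _ := by ring

end IsDriftProcess

end DriftProcess

section LSVBackwardOrbit

lemma two_mul_lsv {a x : ℝ} (hx : 0 ≤ x) (hx' : x ≤ 1 / 2) :
    2 * lsv a x = 2 * x * (1 + (2 * x) ^ a) := by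
  rw [lsv, if_pos hx', Real.mul_rpow zero_le_two hx]
  ring

lemma lsv_le_lsv_iff {a x y : ℝ} (ha : 0 ≤ a) (hx : x ∈ Ioc (0 : ℝ) (1 / 2))
    (hy : y ∈ Ioc (0 : ℝ) (1 / 2)) : lsv a x ≤ lsv a y ↔ x ≤ y := by
  have hmono : StrictMonoOn (lsv a) (Ioc 0 (1 / 2)) := fun u hu v hv huv ↦ by
    have h1 := two_mul_lsv (a := a) hu.1.le hu.2
    have h2 := two_mul_lsv (a := a) hv.1.le hv.2
    have h3 : (2 * u) ^ a ≤ (2 * v) ^ a :=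
      Real.rpow_le_rpow (by linarith [hu.1]) (by linarith) ha
    have h4 : 0 < (2 * u) ^ a := Real.rpow_pos_of_pos (by linarith [hu.1]) _
    have h5 : 2 * u * (1 + (2 * u) ^ a) < 2 * v * (1 + (2 * v) ^ a) := by
      have := hu.1
      have := hv.1
      exact mul_lt_mul (by linarith) (by linarith) (by linarith) (by linarith)
    linarith
  exact hmono.le_iff_le hx hy

variable {α β p₁ : ℝ} {X : ℕ → ℝ → ℝ}

lemma measurable_backwardOrbit (hα : 0 < α) (hαβ : α < β)
    (hX1 : ∀ ω, X 1 ω = 1 / 2)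
    (hX : ∀ n, 2 ≤ n → ∀ ω, X n ω ∈ Ioc (0 : ℝ) (1 / 2) ∧
      lsv (alphaOf α β p₁ ω) (X n ω) = X (n - 1) (phiMap p₁ ω)) (n : ℕ) :
    Measurable (X (n + 1)) := by
  have hpar : ∀ ω, 0 ≤ alphaOf α β p₁ ω := fun ω ↦ by
    unfold alphaOf; split_ifs <;> linarith
  induction n with
  | zero =>
    have : X (0 + 1) = fun _ ↦ 1 / 2 := funext hX1
    rw [this]
    exact measurable_const
  | succ n ih =>
    refine measurable_of_Iic fun t ↦ ?_
    rcases le_or_gt t 0 with ht | ht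
    · convert MeasurableSet.empty
      ext ω
      simpa using ht.trans_lt (hX (n + 1 + 1) (by omega) ω).1.1
    rcases le_or_gt t (1 / 2) with ht' | ht'
    · have : X (n + 1 + 1) ⁻¹' Iic t =
          {ω | X (n + 1) (phiMap p₁ ω) ≤ if ω < p₁ then lsv α t else lsv β t} := by
        ext ω
        have h := hX (n + 1 + 1) (by omega) ω
        have h2 := lsv_le_lsv_iff (hpar ω) h.1 ⟨ht, ht'⟩
        rw [h.2, Nat.add_sub_cancel, alphaOf, apply_ite (fun a ↦ lsv a t)] at h2
        exact h2.symm
      rw [this]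
      exact measurableSet_le (ih.comp (measurable_phiMap p₁))
        (Measurable.ite measurableSet_Iio measurable_const measurable_const)
    · convert MeasurableSet.univ
      ext ω
      simpa using (hX (n + 1 + 1) (by omega) ω).1.2.trans ht'.le

/-- One step of the inverse branch of `y ↦ y (1 + y ^ a)` in the coordinate `y ^ (-α)`. -/
lemma rpow_neg_sub_mem_Icc {a y : ℝ} (hα : 0 < α) (hy : 0 < y) :
    y ^ (-α) - (y * (1 + y ^ a)) ^ (-α) ∈
      Icc (α * y ^ (a - α) / (1 + (1 + α) * y ^ a)) (α * y ^ (a - α)) := by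
  have hs : 0 < y ^ a := Real.rpow_pos_of_pos hy _
  have h1 := one_add_rpow_neg_le hs.le hα.le
  have h2 := one_sub_mul_le_rpow_neg (t := 1 + y ^ a) (by positivity) hα.le
  have hu : 0 < y ^ (-α) := Real.rpow_pos_of_pos hy _
  have h3 : y ^ (a - α) = y ^ (-α) * y ^ a := by rw [← Real.rpow_add hy]; ring_nf
  rw [Real.mul_rpow hy.le (by positivity), h3]
  constructor
  · calc α * (y ^ (-α) * y ^ a) / (1 + (1 + α) * y ^ a)
      _ = y ^ (-α) - y ^ (-α) * (1 - α * y ^ a / (1 + (1 + α) * y ^ a)) := by ring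
      _ ≤ _ := by gcongr
  · nlinarith

lemma isDriftProcess_backwardOrbit (hα : 0 < α) (hαβ : α < β)
    (hX1 : ∀ ω, X 1 ω = 1 / 2)
    (hX : ∀ n, 2 ≤ n → ∀ ω, X n ω ∈ Ioc (0 : ℝ) (1 / 2) ∧
      lsv (alphaOf α β p₁ ω) (X n ω) = X (n - 1) (phiMap p₁ ω)) :
    IsDriftProcess α p₁ (α / (2 + α)) (α * (1 + α)) (min 1 ((β - α) / α))
      fun n ω ↦ (2 * X (n + 1) ω) ^ (-α) := by
  have hmem : ∀ n ω, 0 < 2 * X (n + 1 + 1) ω ∧ 2 * X (n + 1 + 1) ω ≤ 1 := fun n ω ↦ by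
    have h := (hX (n + 1 + 1) (by omega) ω).1
    constructor <;> linarith [h.1, h.2]
  have hrec : ∀ n ω, 2 * X (n + 1) (phiMap p₁ ω) =
      2 * X (n + 1 + 1) ω * (1 + (2 * X (n + 1 + 1) ω) ^ alphaOf α β p₁ ω) := fun n ω ↦ by
    have h := hX (n + 1 + 1) (by omega) ω
    rw [← two_mul_lsv h.1.1.le h.1.2, h.2, Nat.add_sub_cancel]
  have hinc := fun n ω ↦ rpow_neg_sub_mem_Icc (a := alphaOf α β p₁ ω) hα (hmem n ω).1
  simp only [← hrec] at hinc
  refine ⟨fun n ↦ ((measurable_backwardOrbit hα hαβ hX1 hX n).const_mul 2).pow_const _,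
    fun ω ↦ by norm_num [hX1], fun n ω hω ↦ ?_, fun n ω ↦ ?_, fun n ω ↦ ?_⟩
  all_goals
    have hi := hinc n ω
    obtain ⟨hy, hy1⟩ := hmem n ω
    set y := 2 * X (n + 1 + 1) ω
  · simp only [alphaOf, if_pos hω, sub_self, Real.rpow_zero, mul_one] at hi
    have h1 : y ^ α ≤ 1 := Real.rpow_le_one hy.le hy1 hα.le
    have h2 : α / (2 + α) ≤ α / (1 + (1 + α) * y ^ α) := by
      refine div_le_div_of_nonneg_left hα.le (by positivity) ?_
      nlinarith
    linarith [hi.1]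
  · have h1 : 0 ≤ α * y ^ (alphaOf α β p₁ ω - α) / (1 + (1 + α) * y ^ alphaOf α β p₁ ω) := by
      positivity
    linarith [hi.1]
  · have hpow : ∀ s : ℝ, min 1 ((β - α) / α) * α ≤ s →
        y ^ s ≤ (y ^ (-α)) ^ (-min 1 ((β - α) / α)) := fun s hs ↦ by
      rw [← Real.rpow_mul hy.le, neg_mul_neg, mul_comm]
      exact Real.rpow_le_rpow_of_exponent_ge hy hy1 hs
    have hα1 := hpow α (mul_le_of_le_one_left hα.le (min_le_left _ _))
    have hβ1 := hpow (β - α) (by rw [← le_div_iff₀ hα]; exact min_le_right _ _)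
    split_ifs with hω
    · simp only [alphaOf, if_pos hω, sub_self, Real.rpow_zero, mul_one] at hi
      have hs : 0 < y ^ α := Real.rpow_pos_of_pos hy _
      have h1 : α - α * (1 + α) * y ^ α ≤ α / (1 + (1 + α) * y ^ α) := by
        rw [le_div_iff₀ (by positivity)]
        nlinarith [mul_nonneg hα.le (sq_nonneg ((1 + α) * y ^ α))]
      have h2 : α * (1 + α) * y ^ α ≤
          α * (1 + α) * (y ^ (-α)) ^ (-min 1 ((β - α) / α)) := by gcongr
      rw [abs_le]
      constructor <;> linarith [hi.1, hi.2]
    · simp only [alphaOf, if_neg hω] at hi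
      have h0 : 0 ≤ α * y ^ (β - α) / (1 + (1 + α) * y ^ β) := by positivity
      have h2 : α * y ^ (β - α) ≤
          α * (1 + α) * (y ^ (-α)) ^ (-min 1 ((β - α) / α)) := by
        gcongr
        nlinarith
      rw [sub_zero, abs_of_nonneg (h0.trans hi.1)]
      exact hi.2.trans h2

end LSVBackwardOrbit

/-- Theorem 1.1, L¹ part: for `0 < α < β < ∞`,
`∫₀¹ |n^{1/α} x_n(ω) − (1/2)(α p₁)^{-1/α}| dω → 0`. -/
theorem quenched_asymptotics_L1 (α β p₁ : ℝ) (hα : 0 < α) (hαβ : α < β)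
    (hp₁ : 0 < p₁) (hp₁' : p₁ < 1)
    (X : ℕ → ℝ → ℝ) (hX1 : ∀ ω, X 1 ω = 1 / 2)
    (hX : ∀ n, 2 ≤ n → ∀ ω, X n ω ∈ Ioc (0 : ℝ) (1 / 2) ∧
      lsv (alphaOf α β p₁ ω) (X n ω) = X (n - 1) (phiMap p₁ ω)) :
    Tendsto
      (fun n : ℕ =>
        ∫ ω in Icc (0 : ℝ) 1, |(n : ℝ) ^ (1 / α) * X n ω - (1 / 2 : ℝ) * (α * p₁) ^ (-(1 / α))|)
      atTop (𝓝 0) := by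
  have hβα : 0 < β - α := sub_pos.2 hαβ
  have hlim := ((isDriftProcess_backwardOrbit hα hαβ hX1 hX).tendsto_integral_abs_rpow_neg_sub hα
    hp₁ hp₁' (by positivity) (by positivity) (lt_min one_pos (div_pos hβα hα))
    (one_div_pos.2 hα)).const_mul (1 / 2)
  rw [mul_zero] at hlim
  refine (tendsto_add_atTop_iff_nat 1).1 (hlim.congr fun n ↦ ?_)
  rw [← integral_const_mul]
  refine integral_congr_ae (Eventually.of_forall fun ω ↦ ?_)
  have hx : 0 < 2 * X (n + 1) ω := by
    rcases n.eq_zero_or_pos with rfl | hn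
    · norm_num [hX1]
    · linarith [(hX (n + 1) (by omega) ω).1.1]
  have hN : (0 : ℝ) < (n : ℝ) + 1 := by positivity
  have hpow : ((2 * X (n + 1) ω) ^ (-α) / ((n : ℝ) + 1)) ^ (-(1 / α)) =
      ((n : ℝ) + 1) ^ (1 / α) * (2 * X (n + 1) ω) := by
    rw [Real.div_rpow (by positivity) hN.le, ← Real.rpow_mul hx.le, neg_mul_neg,
      mul_one_div_cancel hα.ne', Real.rpow_one, Real.rpow_neg hN.le, div_inv_eq_mul, mul_comm]
  dsimp only
  rw [hpow, ← abs_of_pos (one_half_pos (α := ℝ)), ← abs_mul, abs_of_pos (one_half_pos (α := ℝ))]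
  congr 1
  push_cast
  ring
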